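/- Assume n ≥ 4, r even, and r/p even, and let G = G(r,p,n) and g = (1,−2) := ξ_2^{r/2}(1,2) ∈ G(r,p,n). Set n' = n−2, f_i = e_i(v_3^r,…,v_n^r) for 1 ≤ i ≤ n'−1, and f_{n'} = (v_3⋯v_n)^{r/p}. Then the χ_g-semi-invariants are S(V^g)^{χ_g} = ⨁_{0≤i<r, 2 ≡ −2(r/p)i (mod r)} ℂ[f_1,…,f_{n'−1}, f_{n'}^r] · f_{n'}^i, a free ℂ[f_1,…,f_{n'−1}, f_{n'}^r]-module with basis {f_{n'}^i : 0 ≤ i < r, 2 ≡ −2(r/p)i (mod r)}. In particular S(V^g)^{χ_g} = 0 unless r = 2p. -/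

import Mathlib

open MvPolynomial Matrix Finset

attribute [local instance] Classical.propDecidable

noncomputable section

/-- The group `G(r,p,n)` of monomial `n×n` matrices whose nonzero entries are `r`-th roots
of unity and such that the product of the nonzero entries raised to the `r/p` power is `1`.
(For a monomial matrix the product of the nonzero entries is `∏ i, ∑ j, M i j`.) -/
def GG (r p n : ℕ) : Set (Matrix (Fin n) (Fin n) ℂ) :=
  {M | (∃ (σ : Equiv.Perm (Fin n)) (d : Fin n → ℂ),
          (∀ j, d j ^ r = 1) ∧ ∀ i j, M i j = if i = σ j then d j else 0) ∧
       (∏ i, ∑ j, M i j) ^ (r / p) = 1}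

/-- The centralizer of `g` in `G(r,p,n)`. -/
def Zg (r p n : ℕ) (g : Matrix (Fin n) (Fin n) ℂ) : Set (Matrix (Fin n) (Fin n) ℂ) :=
  {h | h ∈ GG r p n ∧ h * g = g * h}

/-- The action of a matrix `M` on `S(V) = ℂ[v_1,…,v_n]`, sending the variable `X j`
(the `j`-th basis vector of `V`) to the linear form corresponding to `M · e_j`. -/
def act {n : ℕ} (M : Matrix (Fin n) (Fin n) ℂ) :
    MvPolynomial (Fin n) ℂ →ₐ[ℂ] MvPolynomial (Fin n) ℂ :=
  aeval fun j => ∑ i, C (M i j) * X i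

/-- `S(V^g)`: the subalgebra of `S(V)` generated by the linear forms corresponding to
vectors fixed by `g`. -/
def SVg {n : ℕ} (g : Matrix (Fin n) (Fin n) ℂ) : Subalgebra ℂ (MvPolynomial (Fin n) ℂ) :=
  Algebra.adjoin ℂ {q | ∃ c : Fin n → ℂ, g.mulVec c = c ∧ q = ∑ i, C (c i) * X i}

/-- The fixed space `V^g` inside Euclidean space `ℂⁿ`. -/
def fixedSpace {n : ℕ} (M : Matrix (Fin n) (Fin n) ℂ) :
    Submodule ℂ (EuclideanSpace ℂ (Fin n)) :=
  LinearMap.ker (Matrix.toEuclideanLin M - LinearMap.id)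

/-- The determinant of the restriction of an endomorphism to an invariant subspace
(junk value `0` if the subspace is not invariant). -/
def detOn {n : ℕ} (f : EuclideanSpace ℂ (Fin n) →ₗ[ℂ] EuclideanSpace ℂ (Fin n))
    (W : Submodule ℂ (EuclideanSpace ℂ (Fin n))) : ℂ :=
  if h : ∀ x ∈ W, f x ∈ W then LinearMap.det (f.restrict h) else 0

/-- The Hochschild character `χ_g(h) = det(h^⊥)`: the determinant of `h` restricted to the
orthogonal complement of the fixed space `V^g`. -/
def chi {n : ℕ} (g h : Matrix (Fin n) (Fin n) ℂ) : ℂ :=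
  detOn (Matrix.toEuclideanLin h) (fixedSpace g)ᗮ

/-- The element `(1,−2) = ξ₂^{r/2}(1,2)`, sending `v₂ ↦ v₁` and `v₁ ↦ −v₂`
(the nonzero entry in column `1` is `ξ^{r/2} = −1`). -/
def gOneMinusTwo (r n : ℕ) [NeZero n] (ξ : ℂ) : Matrix (Fin n) (Fin n) ℂ :=
  Matrix.of fun i j : Fin n =>
    if i = Equiv.swap (0 : Fin n) 1 j then (if j = 0 then ξ ^ (r / 2) else 1) else 0

/-- `f_i`: the `i`-th elementary symmetric polynomial in `v₃^r, …, v_n^r`. -/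
def fmid (r n : ℕ) (i : ℕ) : MvPolynomial (Fin n) ℂ :=
  ∑ s ∈ Finset.powersetCard i (Finset.univ.filter fun t : Fin n => 2 ≤ (t : ℕ)),
    ∏ t ∈ s, X t ^ r

/-- `f_{n'} = (v₃ ⋯ v_n)^{r/p}`. -/
def flast (r p n : ℕ) : MvPolynomial (Fin n) ℂ :=
  ∏ t ∈ Finset.univ.filter fun t : Fin n => 2 ≤ (t : ℕ), X t ^ (r / p)

/-- The monomial matrix with entry `d j` at position `(σ j, j)`. -/
def monoMat {n : ℕ} (σ : Equiv.Perm (Fin n)) (d : Fin n → ℂ) : Matrix (Fin n) (Fin n) ℂ :=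
  Matrix.of fun i j => if i = σ j then d j else 0

section Monomial

variable {n : ℕ} (σ : Equiv.Perm (Fin n)) (d : Fin n → ℂ)

lemma monoMat_apply (i j : Fin n) : monoMat σ d i j = if i = σ j then d j else 0 := rfl

lemma monoMat_mulVec (c : Fin n → ℂ) (i : Fin n) :
    (monoMat σ d).mulVec c i = d (σ.symm i) * c (σ.symm i) := by
  simp [Matrix.mulVec, dotProduct, monoMat_apply, ← Equiv.symm_apply_eq]

lemma mul_monoMat (h : Matrix (Fin n) (Fin n) ℂ) (i j : Fin n) :
    (h * monoMat σ d) i j = h i (σ j) * d j := by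
  simp [Matrix.mul_apply, monoMat_apply]

lemma monoMat_mul (h : Matrix (Fin n) (Fin n) ℂ) (i j : Fin n) :
    (monoMat σ d * h) i j = d (σ.symm i) * h (σ.symm i) j := by
  simp [Matrix.mul_apply, monoMat_apply, ← Equiv.symm_apply_eq]

lemma act_monoMat_X (j : Fin n) : act (monoMat σ d) (X j) = C (d j) * X (σ j) := by
  simp [act, monoMat_apply, apply_ite C]

lemma act_monoMat_one (f : MvPolynomial (Fin n) ℂ) :
    act (monoMat σ 1) f = rename σ f := by
  have : act (monoMat σ 1) = rename σ := by
    ext1 j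
    simp [act_monoMat_X]
  rw [this]

lemma coeff_act_monoMat_refl (f : MvPolynomial (Fin n) ℂ) (α : Fin n →₀ ℕ) :
    coeff α (act (monoMat (Equiv.refl _) d) f) = (∏ j, d j ^ α j) * coeff α f := by
  induction f using MvPolynomial.induction_on' with
  | monomial β c =>
    have : act (monoMat (Equiv.refl _) d) (monomial β c) =
        monomial β ((∏ j, d j ^ β j) * c) := by
      rw [monomial_eq, map_mul, Finsupp.prod_fintype _ _ (by simp), map_prod,
        monomial_eq, Finsupp.prod_fintype _ _ (by simp)]
      simp only [map_pow, act_monoMat_X, mul_pow, Finset.prod_mul_distrib, C_mul, map_prod]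
      rw [show act (monoMat (Equiv.refl _) d) (C c) = C c from
        (act (monoMat (Equiv.refl _) d)).commutes c]
      simp only [Equiv.refl_apply]
      ring
    rw [this, coeff_monomial, coeff_monomial]
    split_ifs with h
    · rw [h]
    · simp
  | add f g hf hg => rw [map_add, coeff_add, hf, hg, coeff_add]; ring

lemma prod_sum_monoMat : ∏ i, ∑ j, monoMat σ d i j = ∏ j, d j := by
  simp [monoMat_apply, ← Equiv.symm_apply_eq, Equiv.prod_comp σ.symm d]

variable {σ d} in
lemma monoMat_mem_GG {r p : ℕ} (hd : ∀ j, d j ^ r = 1) (hprod : (∏ j, d j) ^ (r / p) = 1) :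
    monoMat σ d ∈ GG r p n :=
  ⟨⟨σ, d, hd, fun _ _ => rfl⟩, by rwa [prod_sum_monoMat]⟩

lemma exists_monoMat_of_mem_GG {r p : ℕ} {h : Matrix (Fin n) (Fin n) ℂ} (hh : h ∈ GG r p n) :
    ∃ σ d, h = monoMat σ d ∧ (∀ j, d j ^ r = 1) ∧ (∏ j, d j) ^ (r / p) = 1 := by
  obtain ⟨⟨σ, d, hd, hM⟩, hprod⟩ := hh
  obtain rfl : h = monoMat σ d := by ext i j; exact hM i j
  exact ⟨σ, d, rfl, hd, by rwa [prod_sum_monoMat] at hprod⟩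

end Monomial

section Twist

variable {m : ℕ}

lemma gOneMinusTwo_eq_monoMat (r : ℕ) (ξ : ℂ) :
    gOneMinusTwo r (m + 2) ξ = monoMat (Equiv.swap 0 1) (Function.update 1 0 (ξ ^ (r / 2))) := by
  ext i j
  simp [gOneMinusTwo, monoMat_apply, Function.update_apply]

lemma gOneMinusTwo_mulVec_eq_iff (r : ℕ) (ξ : ℂ) (c : Fin (m + 2) → ℂ) :
    (gOneMinusTwo r (m + 2) ξ).mulVec c = c ↔ c 1 = c 0 ∧ ξ ^ (r / 2) * c 0 = c 1 := by
  have hs (k : Fin m) : (Equiv.swap (0 : Fin (m + 2)) 1) k.succ.succ = k.succ.succ :=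
    Equiv.swap_apply_of_ne_of_ne (Fin.succ_ne_zero _) (by simp [Fin.ext_iff])
  rw [gOneMinusTwo_eq_monoMat, funext_iff, Fin.forall_fin_succ, Fin.forall_fin_succ]
  simp [monoMat_mulVec, hs, Fin.succ_ne_zero]

lemma commute_gOneMinusTwo_iff {r : ℕ} {ξ : ℂ} (hξ : ξ ^ (r / 2) = -1)
    (h : Matrix (Fin (m + 2)) (Fin (m + 2)) ℂ) :
    h * gOneMinusTwo r (m + 2) ξ = gOneMinusTwo r (m + 2) ξ * h ↔
      h 1 1 = h 0 0 ∧ h 1 0 = - h 0 1 ∧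
      ∀ k : Fin m, h 0 k.succ.succ = 0 ∧ h 1 k.succ.succ = 0 ∧
        h k.succ.succ 0 = 0 ∧ h k.succ.succ 1 = 0 := by
  have hs (k : Fin m) : (Equiv.swap (0 : Fin (m + 2)) 1) k.succ.succ = k.succ.succ :=
    Equiv.swap_apply_of_ne_of_ne (Fin.succ_ne_zero _) (by simp [Fin.ext_iff])
  rw [gOneMinusTwo_eq_monoMat, ← Matrix.ext_iff]
  simp only [mul_monoMat, monoMat_mul, Fin.forall_fin_succ (n := m + 1), Fin.forall_fin_succ (n := m),
    Equiv.symm_swap]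
  simp only [Fin.succ_zero_eq_one, Equiv.swap_apply_left, Equiv.swap_apply_right, hs, hξ,
    Function.update_apply, Fin.succ_ne_zero, Pi.one_apply, one_ne_zero]
  simp only [if_true, if_false, mul_one, one_mul]
  constructor
  · rintro ⟨⟨h1, h2, h3⟩, ⟨h4, h5, h6⟩, h7⟩
    refine ⟨by simpa using h2.symm, by rw [← h1]; ring, fun k => ?_⟩
    have a := h3 k
    have b := h6 k
    have c := (h7 k).1
    have d := (h7 k).2.1
    refine ⟨?_, ?_, ?_, ?_⟩ <;> grind
  · rintro ⟨h1, h2, h3⟩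
    refine ⟨⟨?_, ?_, fun k => ?_⟩, ⟨?_, ?_, fun k => ?_⟩, fun k => ⟨?_, ?_, ?_⟩⟩ <;>
      first | (have := h3 k; grind) | grind

lemma fixedSpace_orthogonal {r : ℕ} {ξ : ℂ} (hξ : ξ ^ (r / 2) = -1)
    (x : EuclideanSpace ℂ (Fin (m + 2))) :
    x ∈ (fixedSpace (gOneMinusTwo r (m + 2) ξ))ᗮ ↔ ∀ k : Fin m, x k.succ.succ = 0 := by
  have hmem (y : EuclideanSpace ℂ (Fin (m + 2))) :
      y ∈ fixedSpace (gOneMinusTwo r (m + 2) ξ) ↔ y 0 = 0 ∧ y 1 = 0 := by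
    have := gOneMinusTwo_mulVec_eq_iff (m := m) r ξ y.ofLp
    rw [hξ] at this
    rw [fixedSpace, LinearMap.mem_ker, LinearMap.sub_apply, sub_eq_zero, Matrix.toLpLin_apply,
      LinearMap.id_apply, ← (WithLp.ofLp_injective 2).eq_iff, this]
    grind
  rw [Submodule.mem_orthogonal]
  constructor
  · intro h k
    have := h (EuclideanSpace.single k.succ.succ 1)
      ((hmem _).2 ⟨by simp [Fin.ext_iff], by simp [Fin.ext_iff]⟩)
    simpa [EuclideanSpace.inner_single_left] using this
  · intro h y hy
    obtain ⟨h0, h1⟩ := (hmem y).1 hy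
    simp [PiLp.inner_apply, Fin.sum_univ_succ, h, h0, h1]

/-- Vectors of `ℂ²` as elements of the orthogonal complement of the fixed space. -/
def planeEquiv {r : ℕ} {ξ : ℂ} (hξ : ξ ^ (r / 2) = -1) :
    (fixedSpace (gOneMinusTwo r (m + 2) ξ))ᗮ ≃ₗ[ℂ] (Fin 2 → ℂ) where
  toFun x := ![x.1 0, x.1 1]
  map_add' x y := by simp
  map_smul' c x := by simp
  invFun v := ⟨WithLp.toLp 2 (Fin.cons (v 0) (Fin.cons (v 1) 0)), by
    rw [fixedSpace_orthogonal hξ]; intro k; simp⟩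
  left_inv x := by
    have hx := (fixedSpace_orthogonal hξ x.1).1 x.2
    ext i
    refine Fin.cases ?_ (fun i => Fin.cases ?_ (fun k => ?_) i) i
    · simp
    · simp
    · simp [hx k]
  right_inv v := by
    ext i
    fin_cases i <;> simp

lemma planeEquiv_apply {r : ℕ} {ξ : ℂ} (hξ : ξ ^ (r / 2) = -1)
    (x : (fixedSpace (gOneMinusTwo r (m + 2) ξ))ᗮ) :
    planeEquiv hξ x = ![x.1 0, x.1 1] := rfl

lemma coe_planeEquiv_symm {r : ℕ} {ξ : ℂ} (hξ : ξ ^ (r / 2) = -1) (v : Fin 2 → ℂ) :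
    (((planeEquiv hξ).symm v : (fixedSpace (gOneMinusTwo r (m + 2) ξ))ᗮ) :
      EuclideanSpace ℂ (Fin (m + 2))) = WithLp.toLp 2 (Fin.cons (v 0) (Fin.cons (v 1) 0)) := rfl

lemma chi_gOneMinusTwo {r : ℕ} {ξ : ℂ} (hξ : ξ ^ (r / 2) = -1)
    {h : Matrix (Fin (m + 2)) (Fin (m + 2)) ℂ}
    (hh : h * gOneMinusTwo r (m + 2) ξ = gOneMinusTwo r (m + 2) ξ * h) :
    chi (gOneMinusTwo r (m + 2) ξ) h = h 0 0 ^ 2 + h 1 0 ^ 2 := by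
  obtain ⟨h11, h10, hz⟩ := (commute_gOneMinusTwo_iff hξ h).1 hh
  have key : ∀ x ∈ (fixedSpace (gOneMinusTwo r (m + 2) ξ))ᗮ,
      Matrix.toEuclideanLin h x ∈ (fixedSpace (gOneMinusTwo r (m + 2) ξ))ᗮ := by
    intro x hx
    rw [fixedSpace_orthogonal hξ] at hx ⊢
    intro k
    simp [Matrix.toLpLin_apply, Matrix.mulVec, dotProduct, Fin.sum_univ_succ, hx, hz k]
  rw [chi, detOn, dif_pos key, ← LinearMap.det_conj _ (planeEquiv hξ)]
  have : (planeEquiv hξ).toLinearMap ∘ₗ (Matrix.toEuclideanLin h).restrict key ∘ₗ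
      (planeEquiv hξ).symm.toLinearMap = Matrix.toLin' !![h 0 0, h 0 1; h 1 0, h 1 1] := by
    refine LinearMap.ext fun v => ?_
    ext i
    fin_cases i <;>
    simp [planeEquiv_apply, coe_planeEquiv_symm, LinearMap.restrict_apply, Matrix.toLpLin_apply, Matrix.mulVec, dotProduct, Fin.sum_univ_succ]
  rw [this, LinearMap.det_toLin', Matrix.det_fin_two_of, h11, h10]
  ring


lemma exists_monoMat_of_mem_Zg {r p : ℕ} {ξ : ℂ} (hr : 0 < r) (hrp : 2 ∣ r / p)
    (hξ : ξ ^ (r / 2) = -1) {h : Matrix (Fin (m + 2)) (Fin (m + 2)) ℂ}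
    (hh : h ∈ Zg r p (m + 2) (gOneMinusTwo r (m + 2) ξ)) :
    ∃ σ d, h = monoMat σ d ∧ (∀ j, d j ^ r = 1) ∧
      (∀ j : Fin (m + 2), 2 ≤ (j : ℕ) → 2 ≤ (σ j : ℕ)) ∧
      chi (gOneMinusTwo r (m + 2) ξ) h = d 0 ^ 2 ∧
      (d 0 ^ 2 * ∏ t ∈ univ.filter fun t : Fin (m + 2) => 2 ≤ (t : ℕ), d t) ^ (r / p) = 1 := by
  obtain ⟨σ, d, rfl, hd, hprod⟩ := exists_monoMat_of_mem_GG hh.1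
  obtain ⟨h11, h10, hz⟩ := (commute_gOneMinusTwo_iff hξ _).1 hh.2
  have hd0 (j) : d j ≠ 0 := fun h0 => by simpa [h0, hr.ne'] using hd j
  have hσ (j : Fin (m + 2)) : monoMat σ d (σ j) j ≠ 0 := by simpa [monoMat_apply] using hd0 j
  have hge (j : Fin (m + 2)) (hj : 2 ≤ (j : ℕ)) : ∃ k : Fin m, j = k.succ.succ :=
    ⟨⟨j - 2, by omega⟩, by ext; simp; omega⟩
  have hpres (j : Fin (m + 2)) (hj : 2 ≤ (j : ℕ)) : 2 ≤ (σ j : ℕ) := by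
    obtain ⟨k, rfl⟩ := hge j hj
    by_contra! hlt
    have hcases : σ k.succ.succ = 0 ∨ σ k.succ.succ = 1 := by
      simp only [Fin.ext_iff, Fin.val_zero, Fin.val_one]; omega
    have := hσ k.succ.succ
    rcases hcases with e | e <;> rw [e] at this
    · exact this (hz k).1
    · exact this (hz k).2.1
  have hprod2 : ∏ t ∈ univ.filter (fun t : Fin (m + 2) => 2 ≤ (t : ℕ)), d t =
      ∏ k : Fin m, d k.succ.succ := by
    rw [Finset.prod_filter, Fin.prod_univ_succ, Fin.prod_univ_succ]
    simp
  obtain ⟨c, hc⟩ := hrp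
  refine ⟨σ, d, rfl, hd, hpres, ?_, ?_⟩
  all_goals
    have h0 : σ 0 = 0 ∨ σ 0 = 1 := by
      by_contra! hne
      obtain ⟨k, hk⟩ := hge (σ 0) (by
        have h1 := Fin.val_ne_of_ne hne.1
        have h2 := Fin.val_ne_of_ne hne.2
        simp only [Fin.val_zero, Fin.val_one] at h1 h2
        omega)
      have := hσ 0
      rw [hk] at this
      exact this (hz k).2.2.1
    simp only [monoMat_apply] at h11 h10
  · rw [chi_gOneMinusTwo hξ hh.2]
    rcases h0 with e | e <;> simp [monoMat_apply, e]
  · rw [hprod2]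
    rw [Fin.prod_univ_succ, Fin.prod_univ_succ, ← mul_assoc] at hprod
    rw [← hprod, mul_pow, mul_pow _ (∏ k : Fin m, d k.succ.succ), Fin.succ_zero_eq_one]
    congr 1
    have hsq : d 1 = d 0 ∨ d 1 = - d 0 := by
      rcases h0 with e | e
      · rw [e] at h11
        by_cases e1 : σ 1 = 1
        · simp [e1] at h11; exact .inl h11
        · simp [Ne.symm e1] at h11
          exact absurd h11.symm (hd0 0)
      · rw [e] at h10
        by_cases e1 : σ 1 = 0
        · simp [e1] at h10; right; rw [h10, neg_neg]
        · simp [Ne.symm e1] at h10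
          exact absurd h10 (hd0 0)
    rw [hc, pow_mul, pow_mul]
    rcases hsq with e | e <;> rw [e] <;> ring

lemma monoMat_mem_Zg {r p : ℕ} {ξ : ℂ} (hξ : ξ ^ (r / 2) = -1)
    {σ : Equiv.Perm (Fin (m + 2))} {d : Fin (m + 2) → ℂ}
    (hd : ∀ j, d j ^ r = 1) (hprod : (∏ j, d j) ^ (r / p) = 1)
    (hσ0 : σ 0 = 0) (hσ1 : σ 1 = 1) (hd1 : d 1 = d 0) :
    monoMat σ d ∈ Zg r p (m + 2) (gOneMinusTwo r (m + 2) ξ) ∧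
      chi (gOneMinusTwo r (m + 2) ξ) (monoMat σ d) = d 0 ^ 2 := by
  have hcomm : monoMat σ d * gOneMinusTwo r (m + 2) ξ =
      gOneMinusTwo r (m + 2) ξ * monoMat σ d := by
    have h0 (k : Fin m) : σ k.succ.succ ≠ 0 := fun h => by
      have := σ.injective (h.trans hσ0.symm)
      simp at this
    have h1 (k : Fin m) : σ k.succ.succ ≠ 1 := fun h => by
      have := σ.injective (h.trans hσ1.symm)
      simp [Fin.ext_iff] at this
    rw [commute_gOneMinusTwo_iff hξ]
    simp [monoMat_apply, hσ0, hσ1, hd1, (h0 _).symm, (h1 _).symm, Fin.ext_iff (b := (1 : Fin (m + 2)))]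
  refine ⟨⟨monoMat_mem_GG hd hprod, hcomm⟩, ?_⟩
  rw [chi_gOneMinusTwo hξ hcomm]
  simp [monoMat_apply, hσ0]

lemma gOneMinusTwo_zero_mem_Zg (p : ℕ) (ξ : ℂ) :
    gOneMinusTwo 0 (m + 2) ξ ∈ Zg 0 p (m + 2) (gOneMinusTwo 0 (m + 2) ξ) := by
  refine ⟨?_, rfl⟩
  rw [gOneMinusTwo_eq_monoMat]
  exact monoMat_mem_GG (by simp) (by simp)

lemma chi_gOneMinusTwo_zero (ξ : ℂ) :
    chi (gOneMinusTwo 0 (m + 2) ξ) (gOneMinusTwo 0 (m + 2) ξ) = -1 := by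
  set g := gOneMinusTwo 0 (m + 2) ξ with hg
  set u : EuclideanSpace ℂ (Fin (m + 2)) :=
    EuclideanSpace.single 0 1 - EuclideanSpace.single 1 1 with hu
  have hfix : fixedSpace g = (ℂ ∙ u)ᗮ := by
    ext y
    have := gOneMinusTwo_mulVec_eq_iff (m := m) 0 ξ y.ofLp
    rw [fixedSpace, LinearMap.mem_ker, LinearMap.sub_apply, sub_eq_zero, Matrix.toLpLin_apply,
      LinearMap.id_apply, ← (WithLp.ofLp_injective 2).eq_iff, this,
      Submodule.mem_orthogonal_singleton_iff_inner_right]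
    simp [hu, inner_sub_left, EuclideanSpace.inner_single_left]
    grind
  have hneg : ∀ x ∈ (fixedSpace g)ᗮ, Matrix.toEuclideanLin g x = -x := by
    intro x hx
    rw [hfix, Submodule.orthogonal_orthogonal] at hx
    obtain ⟨c, rfl⟩ := Submodule.mem_span_singleton.1 hx
    rw [map_smul, ← smul_neg]
    congr 1
    ext i
    rw [hg, gOneMinusTwo_eq_monoMat, Matrix.toLpLin_apply]
    simp only [monoMat_mulVec, hu]
    refine Fin.cases ?_ (fun i => Fin.cases ?_ (fun k => ?_) i) i
    · simp
    · simp
    · have hs : (Equiv.swap (0 : Fin (m + 2)) 1) k.succ.succ = k.succ.succ :=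
        Equiv.swap_apply_of_ne_of_ne (Fin.succ_ne_zero _) (by simp [Fin.ext_iff])
      simp [hs, Fin.ext_iff]
  have hu0 : u ≠ 0 := fun h => by
    have := congrArg (fun v : EuclideanSpace ℂ (Fin (m + 2)) => v 0) h
    simp [hu] at this
  have key : ∀ x ∈ (fixedSpace g)ᗮ, Matrix.toEuclideanLin g x ∈ (fixedSpace g)ᗮ := fun x hx => by
    rw [hneg x hx]; exact neg_mem hx
  have hid : (Matrix.toEuclideanLin g).restrict key = (-1 : ℂ) • LinearMap.id := by
    ext1 x
    apply Subtype.ext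
    simp [LinearMap.restrict_apply, hneg x.1 x.2]
  rw [chi, detOn, dif_pos key, hid, LinearMap.det_smul, LinearMap.det_id, hfix,
    Submodule.orthogonal_orthogonal, finrank_span_singleton hu0]
  simp

lemma act_eq_self_of_mem_SVg {n : ℕ} {g : Matrix (Fin n) (Fin n) ℂ} {f : MvPolynomial (Fin n) ℂ}
    (hf : f ∈ SVg g) : act g f = f := by
  suffices h : SVg g ≤ AlgHom.equalizer (act g) (AlgHom.id ℂ _) from h hf
  refine Algebra.adjoin_le ?_
  rintro _ ⟨c, hc, rfl⟩
  change act g (∑ i, C (c i) * X i) = ∑ i, C (c i) * X i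
  conv_rhs => rw [← hc]
  have hC (z : ℂ) : act g (C z) = C z := (act g).commutes z
  simp only [map_sum, map_mul, hC, Matrix.mulVec, dotProduct]
  simp only [act, aeval_X, Finset.mul_sum, Finset.sum_mul]
  rw [Finset.sum_comm]
  refine Finset.sum_congr rfl fun i _ => Finset.sum_congr rfl fun j _ => by ring

lemma mem_SVg_iff {r : ℕ} {ξ : ℂ} (hξ : ξ ^ (r / 2) = -1) (f : MvPolynomial (Fin (m + 2)) ℂ) :
    f ∈ SVg (gOneMinusTwo r (m + 2) ξ) ↔
      ∃ q : MvPolynomial (Fin m) ℂ, rename (fun k => k.succ.succ) q = f := by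
  suffices h : SVg (gOneMinusTwo r (m + 2) ξ) =
      (rename (R := ℂ) fun k : Fin m => k.succ.succ).range by rw [h]; rfl
  apply le_antisymm
  · refine Algebra.adjoin_le ?_
    rintro _ ⟨c, hc, rfl⟩
    rw [gOneMinusTwo_mulVec_eq_iff, hξ] at hc
    have h0 : c 0 = 0 := by grind
    have h1 : c 1 = 0 := by grind
    exact ⟨∑ k, C (c k.succ.succ) * X k, by simp [Fin.sum_univ_succ, h0, h1]⟩
  · rw [← Algebra.map_top, ← adjoin_range_X, AlgHom.map_adjoin]
    refine Algebra.adjoin_mono ?_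
    rintro _ ⟨_, ⟨k, rfl⟩, rfl⟩
    refine ⟨Pi.single k.succ.succ 1, ?_, ?_⟩
    · rw [gOneMinusTwo_mulVec_eq_iff]
      simp [Fin.ext_iff]
    · simp [Pi.single_apply, apply_ite C]

end Twist

lemma eq_of_dvd_two_add {p r a : ℕ} (hr : 0 < r) (hpr : p ∣ r) (hrp : 2 ∣ r / p)
    (h1 : r / p ∣ a) (h2 : r ∣ 2 + 2 * a) :
    r = 2 * p ∧ Odd p ∧ ∃ b, a = p - 1 + r * b := by
  obtain ⟨c, hc⟩ := hrp
  have hr' : r = p * (2 * c) := by rw [← hc, Nat.mul_div_cancel' hpr]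
  rw [hc] at h1
  obtain ⟨e, rfl⟩ := h1
  obtain ⟨t, ht⟩ := h2
  have hct : c * (p * t) = 1 + c * (2 * e) := by
    rw [hr'] at ht
    apply Nat.eq_of_mul_eq_mul_left two_pos
    linarith
  have hc1 : c = 1 := by
    have : c ∣ 1 := (Nat.dvd_add_left (dvd_mul_right c (2 * e))).1 ⟨_, hct.symm⟩
    exact Nat.dvd_one.1 this
  subst hc1
  have hodd : Odd (p * t) := ⟨e, by linarith⟩
  obtain ⟨hp, b, hb⟩ := Nat.odd_mul.1 hodd
  refine ⟨by linarith, hp, b, ?_⟩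
  have hp1 : 1 ≤ p := hp.pos
  have h1 : p * (2 * b + 1) = 2 * (p * b) + p := by ring
  have h2 : p * (2 * 1) * b = 2 * (p * b) := by ring
  rw [hb, h1] at hct
  rw [hr', h2]
  omega

section Generators

variable {m : ℕ}

lemma filter_two_le_eq_map :
    (univ.filter fun t : Fin (m + 2) => 2 ≤ (t : ℕ)) =
      univ.map ((Fin.succEmb m).trans (Fin.succEmb (m + 1))) := by
  ext t
  refine Fin.cases ?_ (fun i => Fin.cases ?_ (fun k => ?_) i) t
  · simp
  · simp [Fin.ext_iff]
  · simp

lemma fmid_eq_rename (r i : ℕ) :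
    fmid r (m + 2) i = rename (fun k : Fin m => k.succ.succ) (expand r (esymm (Fin m) ℂ i)) := by
  rw [fmid, filter_two_le_eq_map, Finset.powersetCard_map]
  simp [esymm, map_sum, map_prod]

lemma flast_eq_rename (r p : ℕ) :
    flast r p (m + 2) = rename (fun k : Fin m => k.succ.succ) ((∏ k, X k) ^ (r / p)) := by
  rw [flast, filter_two_le_eq_map]
  simp [map_prod, Finset.prod_pow]

lemma fmid_top {r p : ℕ} (hpr : p ∣ r) : fmid r (m + 2) m = flast r p (m + 2) ^ p := by
  have hcard : #(univ.filter fun t : Fin (m + 2) => 2 ≤ (t : ℕ)) = m := by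
    rw [filter_two_le_eq_map]; simp
  have hself : Finset.powersetCard m (univ.filter fun t : Fin (m + 2) => 2 ≤ (t : ℕ)) =
      {univ.filter fun t : Fin (m + 2) => 2 ≤ (t : ℕ)} := by
    conv_lhs => arg 1; rw [← hcard]
    exact Finset.powersetCard_self _
  rw [fmid, hself, Finset.sum_singleton, flast, ← Finset.prod_pow]
  simp_rw [← pow_mul, Nat.div_mul_cancel hpr]

variable {n : ℕ} {σ : Equiv.Perm (Fin n)} {d : Fin n → ℂ}

lemma map_filter_two_le (hσ : ∀ j : Fin n, 2 ≤ (j : ℕ) → 2 ≤ (σ j : ℕ)) :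
    (univ.filter fun t : Fin n => 2 ≤ (t : ℕ)).map σ.toEmbedding =
      univ.filter fun t : Fin n => 2 ≤ (t : ℕ) := by
  refine Finset.eq_of_subset_of_card_le (fun t ht => ?_) (by simp)
  simp only [Finset.mem_map, Finset.mem_filter, Finset.mem_univ, true_and] at ht ⊢
  obtain ⟨j, hj, rfl⟩ := ht
  exact hσ j hj

lemma act_monoMat_fmid {r : ℕ} (hd : ∀ j, d j ^ r = 1)
    (hσ : ∀ j : Fin n, 2 ≤ (j : ℕ) → 2 ≤ (σ j : ℕ)) (i : ℕ) :
    act (monoMat σ d) (fmid r n i) = fmid r n i := by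
  conv_rhs => rw [fmid, ← map_filter_two_le hσ, Finset.powersetCard_map]
  simp [fmid, map_sum, map_prod, act_monoMat_X, mul_pow, ← C_pow, hd]

lemma act_monoMat_flast (r p : ℕ) (hσ : ∀ j : Fin n, 2 ≤ (j : ℕ) → 2 ≤ (σ j : ℕ)) :
    act (monoMat σ d) (flast r p n) =
      (∏ t ∈ univ.filter (fun t : Fin n => 2 ≤ (t : ℕ)), d t) ^ (r / p) • flast r p n := by
  have h : flast r p n = ∏ t ∈ univ.filter (fun t : Fin n => 2 ≤ (t : ℕ)), X (σ t) ^ (r / p) := by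
    rw [flast, ← map_filter_two_le hσ, Finset.prod_map, map_filter_two_le hσ]
    rfl
  conv_rhs => rw [h]
  rw [flast, smul_eq_C_mul]
  simp [map_prod, act_monoMat_X, mul_pow, Finset.prod_mul_distrib, Finset.prod_pow]

end Generators

section SemiInvariants

variable {m : ℕ} {r p : ℕ} {ξ : ℂ}

lemma isSymmetric_of_semiinvariant (hξ : ξ ^ (r / 2) = -1) {q : MvPolynomial (Fin m) ℂ}
    (hq : ∀ h ∈ Zg r p (m + 2) (gOneMinusTwo r (m + 2) ξ),
      act h (rename (fun k : Fin m => k.succ.succ) q) =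
        chi (gOneMinusTwo r (m + 2) ξ) h • rename (fun k : Fin m => k.succ.succ) q) :
    q.IsSymmetric := by
  intro e
  set σ : Equiv.Perm (Fin (m + 2)) :=
    Equiv.Perm.decomposeFin.symm (0, Equiv.Perm.decomposeFin.symm (0, e)) with hσ
  have hσk (k : Fin m) : σ k.succ.succ = (e k).succ.succ := by
    simp [hσ, Equiv.Perm.decomposeFin_symm_apply_succ]
  obtain ⟨hmem, hchi⟩ := monoMat_mem_Zg (p := p) (σ := σ) (d := 1) hξ (by simp) (by simp)
    (by simp [hσ]) (by
      rw [hσ, ← Fin.succ_zero_eq_one, Equiv.Perm.decomposeFin_symm_apply_succ]; simp) rfl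
  have := hq _ hmem
  rw [hchi, act_monoMat_one, rename_rename] at this
  apply rename_injective (fun k : Fin m => k.succ.succ)
    ((Fin.succ_injective _).comp (Fin.succ_injective _))
  simpa [rename_rename, Function.comp_def, hσk] using this

lemma coeff_semiinvariant (hξ : ξ ^ (r / 2) = -1) {q : MvPolynomial (Fin m) ℂ}
    (hq : ∀ h ∈ Zg r p (m + 2) (gOneMinusTwo r (m + 2) ξ),
      act h (rename (fun k : Fin m => k.succ.succ) q) =
        chi (gOneMinusTwo r (m + 2) ξ) h • rename (fun k : Fin m => k.succ.succ) q)
    {a : ℂ} (ha : a ^ r = 1) {d : Fin m → ℂ} (hd : ∀ k, d k ^ r = 1)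
    (hprod : (a ^ 2 * ∏ k, d k) ^ (r / p) = 1) {α : Fin m →₀ ℕ} (hα : α ∈ q.support) :
    ∏ k, d k ^ α k = a ^ 2 := by
  have hinj : Function.Injective fun k : Fin m => k.succ.succ :=
    (Fin.succ_injective _).comp (Fin.succ_injective _)
  obtain ⟨hmem, hchi⟩ := monoMat_mem_Zg (p := p) (σ := Equiv.refl _)
    (d := Fin.cons a (Fin.cons a d)) hξ
    (by simp [Fin.forall_fin_succ (n := m + 1), Fin.forall_fin_succ (n := m), ha, hd])
    (by simpa [Fin.prod_univ_succ, ← mul_assoc, ← sq] using hprod) rfl rfl rfl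
  have h0 := congrArg (coeff (α.mapDomain fun k => k.succ.succ)) (hq _ hmem)
  rw [coeff_act_monoMat_refl, hchi, coeff_smul, coeff_rename_mapDomain _ hinj, smul_eq_mul] at h0
  have hmap0 : (α.mapDomain fun k : Fin m => k.succ.succ) 0 = 0 :=
    Finsupp.mapDomain_of_notMem_range _ _ (by simp [Fin.succ_ne_zero])
  have hmap1 : (α.mapDomain fun k : Fin m => k.succ.succ) 1 = 0 :=
    Finsupp.mapDomain_of_notMem_range _ _ (by simp [Fin.ext_iff])
  have hmapk (k : Fin m) : (α.mapDomain fun k : Fin m => k.succ.succ) k.succ.succ = α k :=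
    Finsupp.mapDomain_apply hinj α k
  have := mul_right_cancel₀ (mem_support_iff.1 hα) h0
  simpa [Fin.prod_univ_succ, hmap0, hmap1, hmapk] using this

lemma exponent_of_semiinvariant (hr : 0 < r) (hpr : p ∣ r) (hrp : 2 ∣ r / p)
    (hprim : IsPrimitiveRoot ξ r) (hξ : ξ ^ (r / 2) = -1) {q : MvPolynomial (Fin m) ℂ}
    (hq : ∀ h ∈ Zg r p (m + 2) (gOneMinusTwo r (m + 2) ξ),
      act h (rename (fun k : Fin m => k.succ.succ) q) =
        chi (gOneMinusTwo r (m + 2) ξ) h • rename (fun k : Fin m => k.succ.succ) q)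
    {α : Fin m →₀ ℕ} (hα : α ∈ q.support) (k : Fin m) :
    r = 2 * p ∧ Odd p ∧ ∃ b, α k = p - 1 + r * b := by
  have hξ0 : ξ ≠ 0 := hprim.ne_zero hr.ne'
  have hp : 0 < p := Nat.pos_of_dvd_of_pos hpr hr
  have single (a b : ℂ) (ha : a ^ r = 1) (hb : b ^ r = 1) (hab : (a ^ 2 * b) ^ (r / p) = 1) :
      b ^ α k = a ^ 2 := by
    have := coeff_semiinvariant hξ hq ha (d := Pi.mulSingle k b)
      (fun j => by simp only [Pi.mulSingle_apply]; split_ifs <;> simp [hb])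
      (by simpa using hab) hα
    rw [Finset.prod_eq_single k (by
      intro j _ hj; simp [hj]) (by simp)] at this
    simpa using this
  apply eq_of_dvd_two_add hr hpr hrp
  · have := single 1 (ξ ^ p) (by simp) (by rw [pow_right_comm, hprim.pow_eq_one, one_pow])
      (by rw [one_pow, one_mul, ← pow_mul, Nat.mul_div_cancel' hpr, hprim.pow_eq_one])
    rw [one_pow, ← pow_mul, hprim.pow_eq_one_iff_dvd] at this
    rw [← Nat.mul_div_cancel' hpr] at this
    exact Nat.dvd_of_mul_dvd_mul_left hp this
  · have := single ξ (ξ ^ 2)⁻¹ hprim.pow_eq_one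
      (by rw [inv_pow, pow_right_comm, hprim.pow_eq_one, one_pow, inv_one])
      (by rw [mul_inv_cancel₀ (pow_ne_zero _ hξ0), one_pow])
    rw [← hprim.pow_eq_one_iff_dvd, pow_add, pow_mul]
    rw [inv_pow] at this
    calc ξ ^ 2 * (ξ ^ 2) ^ α k = ((ξ ^ 2) ^ α k)⁻¹ * (ξ ^ 2) ^ α k := by rw [this]
      _ = 1 := inv_mul_cancel₀ (pow_ne_zero _ (pow_ne_zero _ hξ0))

lemma exists_eq_prod_pow_mul_expand {c : ℕ} (q : MvPolynomial (Fin m) ℂ)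
    (hq : ∀ α ∈ q.support, ∀ k, ∃ b, α k = c + r * b) :
    ∃ s, q = (∏ k, X k) ^ c * expand r s := by
  have hmon : ∀ α ∈ q.support, ∃ s, monomial α (coeff α q) = (∏ k, X k) ^ c * expand r s := by
    intro α hα
    choose b hb using hq α hα
    refine ⟨monomial (Finsupp.equivFunOnFinite.symm b) (coeff α q), ?_⟩
    rw [expand_monomial, monomial_eq, monomial_eq, Finsupp.prod_fintype _ _ (by simp),
      Finsupp.prod_fintype _ _ (by simp), ← Finset.prod_pow, mul_left_comm,
      ← Finset.prod_mul_distrib]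
    simp [hb, pow_add]
  choose! s hs using hmon
  refine ⟨∑ α ∈ q.support, s α, ?_⟩
  rw [map_sum, Finset.mul_sum]
  conv_lhs => rw [q.as_sum]
  exact Finset.sum_congr rfl hs

lemma exists_aeval_fmid (hr : 0 < r) {c : ℕ} {q : MvPolynomial (Fin m) ℂ} (hsymm : q.IsSymmetric)
    (hq : ∀ α ∈ q.support, ∀ k, ∃ b, α k = c + r * b) :
    ∃ F : MvPolynomial (Fin m) ℂ, rename (fun k : Fin m => k.succ.succ) q =
      rename (fun k : Fin m => k.succ.succ) (∏ k, X k) ^ c *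
        aeval (fun i : Fin m => fmid r (m + 2) (i + 1)) F := by
  obtain ⟨s, rfl⟩ := exists_eq_prod_pow_mul_expand q hq
  have hprod : (∏ k : Fin m, X k : MvPolynomial (Fin m) ℂ) ≠ 0 :=
    Finset.prod_ne_zero_iff.2 fun k _ => X_ne_zero k
  have hs : s.IsSymmetric := by
    intro e
    have := hsymm e
    rw [map_mul, map_pow, map_prod, rename_expand] at this
    simp only [rename_X, Equiv.prod_comp e (fun k => (X k : MvPolynomial (Fin m) ℂ))] at this
    exact expand_injective hr (mul_left_cancel₀ (pow_ne_zero _ hprod) this)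
  obtain ⟨F, hF⟩ := esymmAlgHom_surjective (σ := Fin m) (R := ℂ) (n := m) (by simp) ⟨s, hs⟩
  refine ⟨F, ?_⟩
  have hval : aeval (fun i : Fin m => esymm (Fin m) ℂ (i + 1)) F = s := by
    rw [← esymmAlgHom_apply, hF]
  rw [map_mul, map_pow, ← hval]
  simp only [fmid_eq_rename]
  congr 1
  exact (AlgHom.congr_fun (comp_aeval (fun i : Fin m => esymm (Fin m) ℂ (i + 1))
    ((rename fun k : Fin m => k.succ.succ).comp (expand r))) F)

lemma aeval_fmid_injective (hr : 0 < r) :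
    Function.Injective (aeval (R := ℂ) fun i : Fin m => fmid r (m + 2) (i + 1)) := by
  have h1 : Function.Injective (aeval (R := ℂ) fun i : Fin m => esymm (Fin m) ℂ (i + 1)) := by
    intro F G h
    rw [← esymmAlgHom_apply, ← esymmAlgHom_apply] at h
    exact esymmAlgHom_injective (σ := Fin m) ℂ (n := m) (by simp) (Subtype.ext h)
  have h2 : (aeval (R := ℂ) fun i : Fin m => fmid r (m + 2) (i + 1)) =
      ((rename fun k : Fin m => k.succ.succ).comp (expand r)).comp
        (aeval (R := ℂ) fun i : Fin m => esymm (Fin m) ℂ (i + 1)) := by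
    rw [comp_aeval]
    simp [fmid_eq_rename]
  rw [h2]
  exact ((rename_injective _ ((Fin.succ_injective _).comp (Fin.succ_injective _))).comp
    (expand_injective hr)).comp h1

end SemiInvariants

section Main

variable {m : ℕ} {r p : ℕ} {ξ : ℂ}

lemma pow_half_eq_neg_one (hr : 0 < r) (hreven : 2 ∣ r) (hprim : IsPrimitiveRoot ξ r) :
    ξ ^ (r / 2) = -1 :=
  (hprim.pow hr (Nat.div_mul_cancel hreven).symm).eq_neg_one_of_two_right

lemma semiinvariant_eq_zero (hm : 0 < m) (hpr : p ∣ r) (hreven : 2 ∣ r)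
    (hrp : 2 ∣ r / p) (hprim : IsPrimitiveRoot ξ r) (hne : ¬ (r = 2 * p ∧ Odd p))
    {f : MvPolynomial (Fin (m + 2)) ℂ} (hf : f ∈ SVg (gOneMinusTwo r (m + 2) ξ))
    (hsemi : ∀ h ∈ Zg r p (m + 2) (gOneMinusTwo r (m + 2) ξ),
      act h f = chi (gOneMinusTwo r (m + 2) ξ) h • f) : f = 0 := by
  rcases Nat.eq_zero_or_pos r with rfl | hr
  · have h := hsemi _ (gOneMinusTwo_zero_mem_Zg p ξ)
    rwa [chi_gOneMinusTwo_zero, act_eq_self_of_mem_SVg hf, neg_one_smul, self_eq_neg] at h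
  · have hξ := pow_half_eq_neg_one hr hreven hprim
    obtain ⟨q, rfl⟩ := (mem_SVg_iff hξ f).1 hf
    by_contra hq0
    obtain ⟨α, hα⟩ := support_nonempty.2 fun h : q = 0 => hq0 (by rw [h, map_zero])
    have := exponent_of_semiinvariant hr hpr hrp hprim hξ hsemi hα ⟨0, hm⟩
    exact hne ⟨this.1, this.2.1⟩

lemma fmid_mem_SVg (hξ : ξ ^ (r / 2) = -1) (i : ℕ) :
    fmid r (m + 2) i ∈ SVg (gOneMinusTwo r (m + 2) ξ) :=
  (mem_SVg_iff hξ _).2 ⟨_, (fmid_eq_rename r i).symm⟩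

lemma flast_mem_SVg (hξ : ξ ^ (r / 2) = -1) :
    flast r p (m + 2) ∈ SVg (gOneMinusTwo r (m + 2) ξ) :=
  (mem_SVg_iff hξ _).2 ⟨_, (flast_eq_rename r p).symm⟩

/-- The coefficient ring `ℂ[f₁, …, f_{n'-1}, f_{n'}^r]`. -/
def coeffRing (r p n : ℕ) : Subalgebra ℂ (MvPolynomial (Fin n) ℂ) :=
  Algebra.adjoin ℂ (insert (flast r p n ^ r) ((fun i => fmid r n i) '' Set.Ico 1 (n - 2)))

lemma semiinvariant_mul_flast_pow (hr : 0 < r) (hreven : 2 ∣ r) (hrp : 2 ∣ r / p)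
    (hprim : IsPrimitiveRoot ξ r) {a : MvPolynomial (Fin (m + 2)) ℂ}
    (ha : a ∈ coeffRing r p (m + 2)) {i : ℕ} (hi : r ∣ 2 + 2 * (r / p) * i) :
    a * flast r p (m + 2) ^ i ∈ SVg (gOneMinusTwo r (m + 2) ξ) ∧
      ∀ h ∈ Zg r p (m + 2) (gOneMinusTwo r (m + 2) ξ),
        act h (a * flast r p (m + 2) ^ i) =
          chi (gOneMinusTwo r (m + 2) ξ) h • (a * flast r p (m + 2) ^ i) := by
  have hξ := pow_half_eq_neg_one hr hreven hprim
  constructor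
  · refine mul_mem ?_ (pow_mem (flast_mem_SVg hξ) _)
    refine Algebra.adjoin_le (S := SVg (gOneMinusTwo r (m + 2) ξ)) ?_ ha
    rintro _ (rfl | ⟨j, -, rfl⟩)
    · exact pow_mem (flast_mem_SVg hξ) _
    · exact fmid_mem_SVg hξ j
  · intro h hh
    obtain ⟨σ, d, rfl, hd, hσ, hchi, hprod⟩ := exists_monoMat_of_mem_Zg hr hrp hξ hh
    set P := ∏ t ∈ univ.filter fun t : Fin (m + 2) => 2 ≤ (t : ℕ), d t with hP
    have hfl : act (monoMat σ d) (flast r p (m + 2)) = P ^ (r / p) • flast r p (m + 2) :=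
      act_monoMat_flast r p hσ
    have hPr : P ^ r = 1 := by rw [hP, ← Finset.prod_pow]; simp [hd]
    have hact : act (monoMat σ d) a = a := by
      suffices h : coeffRing r p (m + 2) ≤
          AlgHom.equalizer (act (monoMat σ d)) (AlgHom.id ℂ _) from h ha
      refine Algebra.adjoin_le ?_
      rintro _ (rfl | ⟨j, -, rfl⟩)
      · change act (monoMat σ d) _ = flast r p (m + 2) ^ r
        rw [map_pow, hfl, smul_pow, pow_right_comm, hPr, one_pow, one_smul]
      · exact act_monoMat_fmid hd hσ j
    rw [map_mul, map_pow, hact, hfl, hchi, smul_pow, mul_smul_comm]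
    congr 1
    have h1 : (d 0 ^ 2) ^ (1 + (r / p) * i) = 1 := by
      obtain ⟨t, ht⟩ := hi
      rw [← pow_mul, show 2 * (1 + r / p * i) = r * t by rw [← ht]; ring, pow_mul, hd, one_pow]
    have h2 : ((d 0 ^ 2 * P) ^ (r / p)) ^ i = 1 := by rw [hprod, one_pow]
    have h3 : d 0 ^ 2 ≠ 0 := fun h0 => by simp [h0] at h1
    apply mul_left_cancel₀ (pow_ne_zero ((r / p) * i) h3)
    rw [mul_pow, mul_pow, ← pow_mul] at h2
    rw [h2, ← pow_succ, add_comm (r / p * i) 1, h1]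

lemma range_filter_dvd_eq {j : ℕ} :
    ((Finset.range (2 * (2 * j + 1))).filter fun i => 2 * (2 * j + 1) ∣ 2 + 2 * 2 * i) =
      {j, j + (2 * j + 1)} := by
  ext i
  simp only [Finset.mem_filter, Finset.mem_range, Finset.mem_insert, Finset.mem_singleton]
  constructor
  · rintro ⟨hi, h⟩
    obtain ⟨-, -, b, hb⟩ := eq_of_dvd_two_add (p := 2 * j + 1) (r := 2 * (2 * j + 1)) (a := 2 * i)
      (by positivity) (dvd_mul_left _ _) (by simp) (by simp)
      (by convert h using 1; ring)
    have hb2 : b < 2 := by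
      by_contra! hb2
      have := Nat.mul_le_mul_left (2 * (2 * j + 1)) hb2
      omega
    interval_cases b <;> omega
  · rintro (rfl | rfl)
    · exact ⟨by omega, 1, by ring⟩
    · exact ⟨by omega, 3, by ring⟩

lemma exists_aeval_fmid_eq_add (hr : r = 2 * p)
    (F : MvPolynomial (Fin m) ℂ) :
    ∃ a ∈ coeffRing r p (m + 2), ∃ b ∈ coeffRing r p (m + 2),
      aeval (fun i : Fin m => fmid r (m + 2) (i + 1)) F = a + b * flast r p (m + 2) ^ p := by
  have hlast : flast r p (m + 2) ^ r ∈ coeffRing r p (m + 2) :=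
    Algebra.subset_adjoin (Set.mem_insert _ _)
  induction F using MvPolynomial.induction_on with
  | C c => exact ⟨algebraMap ℂ _ c, Subalgebra.algebraMap_mem _ _, 0, zero_mem _, by simp⟩
  | add F G hF hG =>
    obtain ⟨a, ha, b, hb, h⟩ := hF
    obtain ⟨a', ha', b', hb', h'⟩ := hG
    exact ⟨a + a', add_mem ha ha', b + b', add_mem hb hb', by rw [map_add, h, h']; ring⟩
  | mul_X F i hF =>
    obtain ⟨a, ha, b, hb, h⟩ := hF
    rw [map_mul, aeval_X, h]
    by_cases hi : (i : ℕ) + 1 = m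
    · refine ⟨b * flast r p (m + 2) ^ r, mul_mem hb hlast, a, ha, ?_⟩
      have hsq : flast r p (m + 2) ^ r = (flast r p (m + 2) ^ p) ^ 2 := by
        rw [← pow_mul]
        congr 1
        omega
      rw [hi, fmid_top (p := p) ⟨2, by omega⟩, hsq]
      ring
    · have hfm : fmid r (m + 2) (i + 1) ∈ coeffRing r p (m + 2) :=
        Algebra.subset_adjoin (Set.mem_insert_of_mem _ ⟨i + 1, ⟨by omega, by omega⟩, rfl⟩)
      exact ⟨_, mul_mem ha hfm, _, mul_mem hb hfm, by ring⟩

lemma eq_zero_of_add_mul_flast_pow_eq_zero (hm : 0 < m) (hr : r = 2 * p) (hp : 0 < p)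
    {a b : MvPolynomial (Fin (m + 2)) ℂ} (ha : a ∈ coeffRing r p (m + 2))
    (hb : b ∈ coeffRing r p (m + 2)) (hab : a + b * flast r p (m + 2) ^ p = 0) :
    a = 0 ∧ b = 0 := by
  set last : Fin m := ⟨m - 1, by omega⟩ with hlast
  set Ψ := aeval (R := ℂ) fun i : Fin m => fmid r (m + 2) (i + 1) with hΨ
  set τ : MvPolynomial (Fin m) ℂ →ₐ[ℂ] MvPolynomial (Fin m) ℂ :=
    aeval fun i => if i = last then - X i else X i with hτ
  have hinj : Function.Injective Ψ := aeval_fmid_injective (by omega)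
  have htop : Ψ (X last) = flast r p (m + 2) ^ p := by
    rw [hΨ, aeval_X, ← fmid_top (p := p) ⟨2, by omega⟩]
    congr 1
    simp only [hlast]
    omega
  have hle : coeffRing r p (m + 2) ≤ (AlgHom.equalizer τ (AlgHom.id ℂ _)).map Ψ := by
    refine Algebra.adjoin_le ?_
    rintro _ (rfl | ⟨i, ⟨hi1, hi2⟩, rfl⟩)
    · refine ⟨X last ^ 2, ?_, ?_⟩
      · change τ (X last ^ 2) = X last ^ 2
        simp [hτ]
      · change Ψ (X last ^ 2) = _
        rw [map_pow, htop, ← pow_mul, hr, mul_comm]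
    · refine ⟨X ⟨i - 1, by omega⟩, ?_, ?_⟩
      · change τ (X _) = X _
        rw [hτ, aeval_X, if_neg]
        simp only [hlast, Fin.ext_iff]
        omega
      · change Ψ (X _) = fmid r (m + 2) i
        rw [hΨ, aeval_X]
        congr 1
        simp only
        omega
  obtain ⟨a, ha', rfl⟩ := hle ha
  obtain ⟨b, hb', rfl⟩ := hle hb
  have ha1 : τ a = a := ha'
  have hb1 : τ b = b := hb'
  replace hab : a + b * X last = 0 := by
    apply hinj
    rw [map_add, map_mul, htop, map_zero]
    exact hab
  have hab' : a - b * X last = 0 := by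
    have h := congrArg τ hab
    rw [map_add, map_mul, ha1, hb1, map_zero] at h
    have hX : τ (X last) = - X last := by simp [hτ]
    rw [hX] at h
    rw [← h]; ring
  have ha0 : a = 0 := by
    have : (2 : MvPolynomial (Fin m) ℂ) * a = 0 := by linear_combination hab + hab'
    simpa using this
  have hb0 : b = 0 := by
    rw [ha0, zero_add] at hab
    exact (mul_eq_zero.1 hab).resolve_right (X_ne_zero last)
  exact ⟨by rw [ha0]; exact map_zero Ψ, by rw [hb0]; exact map_zero Ψ⟩

end Main

/-- Assume `n ≥ 4`, `r` even, `r/p` even, and let `G = G(r,p,n)` and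
`g = (1,−2) = ξ₂^{r/2}(1,2) ∈ G(r,p,n)`.  With `n' = n−2`, `f_i = e_i(v₃^r,…,v_n^r)` and
`f_{n'} = (v₃⋯v_n)^{r/p}`, the `χ_g`-semi-invariants form the free
`ℂ[f₁,…,f_{n'−1}, f_{n'}^r]`-module with basis `{f_{n'}^i : 0 ≤ i < r, 2 ≡ −2(r/p)i (mod r)}`
(the congruence `2 ≡ −2(r/p)i (mod r)` is expressed as `r ∣ 2 + 2(r/p)i`).
In particular `S(V^g)^{χ_g} = 0` unless `r = 2p`. -/
theorem semiinvariants_of_one_minus_two_in_Grpn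
    (r p n : ℕ) [NeZero n] (hn : 4 ≤ n) (hp : 0 < p) (hpr : p ∣ r)
    (hreven : 2 ∣ r) (hrpeven : 2 ∣ r / p)
    (ξ : ℂ) (hξ : IsPrimitiveRoot ξ r)
    (R : Subalgebra ℂ (MvPolynomial (Fin n) ℂ))
    (hR : R = Algebra.adjoin ℂ
        (insert (flast r p n ^ r) ((fun i => fmid r n i) '' Set.Ico 1 (n - 2))))
    (idx : Finset ℕ)
    (hidx : idx = (Finset.range r).filter fun i => r ∣ 2 + 2 * (r / p) * i) :
    ({f : MvPolynomial (Fin n) ℂ |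
        f ∈ SVg (gOneMinusTwo r n ξ) ∧
          ∀ h ∈ Zg r p n (gOneMinusTwo r n ξ),
            act h f = chi (gOneMinusTwo r n ξ) h • f}
      = {f | ∃ a : ℕ → MvPolynomial (Fin n) ℂ,
          (∀ i ∈ idx, a i ∈ R) ∧ f = ∑ i ∈ idx, a i * flast r p n ^ i})
    ∧ (∀ a : ℕ → MvPolynomial (Fin n) ℂ,
        (∀ i ∈ idx, a i ∈ R) → (∑ i ∈ idx, a i * flast r p n ^ i) = 0 →
        ∀ i ∈ idx, a i = 0)
    ∧ (r ≠ 2 * p →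
        ∀ f ∈ SVg (gOneMinusTwo r n ξ),
          (∀ h ∈ Zg r p n (gOneMinusTwo r n ξ),
              act h f = chi (gOneMinusTwo r n ξ) h • f) → f = 0) := by
  obtain ⟨m, rfl⟩ : ∃ m, n = m + 2 := ⟨n - 2, by omega⟩
  have hm : 0 < m := by omega
  have hR' : R = coeffRing r p (m + 2) := hR
  subst hR'
  by_cases hcase : r = 2 * p ∧ Odd p
  swap
  · have hempty : idx = ∅ := by
      rw [hidx, Finset.filter_eq_empty_iff]
      intro i hi hdvd
      obtain ⟨h1, h2, -⟩ := eq_of_dvd_two_add (a := r / p * i)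
        (Nat.pos_of_ne_zero fun h => by simp [h] at hi) hpr hrpeven (dvd_mul_right _ _)
        (by rwa [← mul_assoc])
      exact hcase ⟨h1, h2⟩
    have hzero : ∀ f ∈ SVg (gOneMinusTwo r (m + 2) ξ),
        (∀ h ∈ Zg r p (m + 2) (gOneMinusTwo r (m + 2) ξ),
          act h f = chi (gOneMinusTwo r (m + 2) ξ) h • f) → f = 0 :=
      fun f hf hsemi => semiinvariant_eq_zero hm hpr hreven hrpeven hξ hcase hf hsemi
    refine ⟨?_, by simp [hempty], fun _ => hzero⟩
    ext f
    simp only [hempty, Set.mem_ofPred_eq, Finset.sum_empty]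
    constructor
    · exact fun hf => ⟨0, by simp, hzero f hf.1 hf.2⟩
    · rintro ⟨-, -, rfl⟩
      exact ⟨zero_mem _, by simp⟩
  obtain ⟨hr2, j, hj⟩ := hcase
  have hr : 0 < r := by omega
  have hrp : r / p = 2 := by rw [hr2, Nat.mul_div_cancel _ hp]
  have hneg := pow_half_eq_neg_one hr hreven hξ
  have hidx' : idx = {j, j + p} := by
    rw [hidx, hrp, hr2, hj]
    exact range_filter_dvd_eq
  have hsum (a : ℕ → MvPolynomial (Fin (m + 2)) ℂ) :
      ∑ i ∈ idx, a i * flast r p (m + 2) ^ i =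
        flast r p (m + 2) ^ j * (a j + a (j + p) * flast r p (m + 2) ^ p) := by
    rw [hidx', Finset.sum_pair (by omega), pow_add]
    ring
  refine ⟨?_, ?_, fun h => absurd hr2 h⟩
  · ext f
    simp only [Set.mem_ofPred_eq]
    constructor
    · rintro ⟨hf, hsemi⟩
      obtain ⟨q, rfl⟩ := (mem_SVg_iff hneg f).1 hf
      obtain ⟨F, hF⟩ := exists_aeval_fmid hr (isSymmetric_of_semiinvariant hneg hsemi)
        fun α hα k => (exponent_of_semiinvariant hr hpr hrpeven hξ hneg hsemi hα k).2.2
      obtain ⟨a, ha, b, hb, hab⟩ := exists_aeval_fmid_eq_add hr2 F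
      refine ⟨fun i => if i = j then a else b, fun i _ => ?_, ?_⟩
      · dsimp only; split_ifs <;> assumption
      · rw [hsum, hF, hab, flast_eq_rename, hrp, hj]
        simp [← pow_mul]
    · rintro ⟨a, ha, rfl⟩
      have key (i) (hi : i ∈ idx) := semiinvariant_mul_flast_pow hr hreven hrpeven hξ
        (ha i hi) (by rw [hidx, Finset.mem_filter] at hi; exact hi.2)
      refine ⟨sum_mem fun i hi => (key i hi).1, fun h hh => ?_⟩
      rw [map_sum, Finset.smul_sum]
      exact Finset.sum_congr rfl fun i hi => (key i hi).2 h hh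
  · intro a ha h0
    rw [hsum] at h0
    have hfl : flast r p (m + 2) ≠ 0 :=
      Finset.prod_ne_zero_iff.2 fun t _ => pow_ne_zero _ (X_ne_zero t)
    have := eq_zero_of_add_mul_flast_pow_eq_zero hm hr2 hp (ha j (by simp [hidx']))
      (ha (j + p) (by simp [hidx'])) ((mul_eq_zero.1 h0).resolve_left (pow_ne_zero _ hfl))
    intro i hi
    rw [hidx'] at hi
    simp only [Finset.mem_insert, Finset.mem_singleton] at hi
    rcases hi with rfl | rfl
    exacts [this.1, this.2]

end
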